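/- For every integer r ≥ 2 and every real p > 0, φ(r,p,n) / n^{p+1} converges to ψ(r,p) as n → ∞; that is, φ(r,p,n) = ψ(r,p) · n^{p+1} + o(n^{p+1}). -/

import Mathlib

open Finset

/-- `f(p,G)`: the sum of the `p`-th powers of the vertex degrees of `G`. -/
noncomputable def degPowerSum (p : ℝ) {V : Type*} [Fintype V] (G : SimpleGraph V) : ℝ :=
  letI := Classical.decRel G.Adj
  ∑ u, (G.degree u : ℝ) ^ p

/-- `φ(r,p,n)`: the maximum of `f(p,G)` over `K_{r+1}`-free graphs on `n` vertices. -/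
noncomputable def phiClique (r : ℕ) (p : ℝ) (n : ℕ) : ℝ :=
  sSup {x | ∃ G : SimpleGraph (Fin n), G.CliqueFree (r + 1) ∧ x = degPowerSum p G}

/-- `ψ(r,p)`: the maximum of `∑ x_i (1 - x_i)^p` over the standard simplex. -/
noncomputable def psiMax (r : ℕ) (p : ℝ) : ℝ :=
  sSup {y | ∃ x : Fin r → ℝ, (∀ i, 0 ≤ x i) ∧ ∑ i, x i = 1 ∧
    y = ∑ i, x i * (1 - x i) ^ p}

open Classical in
/-- Degree majorization of Erdős: on a vertex set `S` spanning no `K_{r+1}`, the degrees of `G` are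
dominated by the degrees of a complete `r`-partite graph. -/
theorem exists_coloring_degree_le {V : Type*} (G : SimpleGraph V) (r : ℕ) :
    ∀ S : Finset V, G.CliqueFreeOn (S : Set V) (r + 1) →
      ∃ c : V → ℕ, (∀ u ∈ S, c u < r) ∧
        ∀ u ∈ S, #{w ∈ S | G.Adj u w} ≤ #{w ∈ S | c w ≠ c u} := by
  induction r with
  | zero =>
    intro S hS
    have hempty : ∀ u, u ∉ S := fun u hu =>
      hS (t := {u}) (by simpa using hu) (by simp)
    exact ⟨fun _ => 0, fun u hu => absurd hu (hempty u), fun u hu => absurd hu (hempty u)⟩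
  | succ r ih =>
    intro S hS
    rcases S.eq_empty_or_nonempty with rfl | hne
    · exact ⟨fun _ => 0, by simp, by simp⟩
    obtain ⟨v, hvS, hv⟩ := S.exists_max_image (fun u => #{w ∈ S | G.Adj u w}) hne
    set T := {w ∈ S | G.Adj v w} with hT
    obtain ⟨c, hc, hdeg⟩ := ih T (by
      intro t ht hcl
      refine hS (t := insert v t) ?_ (hcl.insert ?_)
      · intro w hw
        rcases Finset.mem_insert.1 (Finset.mem_coe.1 hw) with rfl | hw
        · exact hvS
        · exact (Finset.mem_filter.1 (ht hw)).1
      · intro w hw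
        exact (Finset.mem_filter.1 (ht hw)).2)
    refine ⟨fun w => if w ∈ T then c w else r, ?_, ?_⟩
    · intro u _
      dsimp only
      split_ifs with h
      · exact (hc u h).trans (Nat.lt_succ_self r)
      · exact Nat.lt_succ_self r
    · intro u hu
      by_cases huT : u ∈ T
      · have hsub : #{w ∈ S | G.Adj u w} ≤ #{w ∈ T | G.Adj u w} + #(S \ T) := by
          refine (Finset.card_le_card ?_).trans (Finset.card_union_le _ _)
          intro w hw
          by_cases hwT : w ∈ T <;> simp_all
        have hdisj : Disjoint {w ∈ T | c w ≠ c u} (S \ T) :=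
          Finset.disjoint_of_subset_left (Finset.filter_subset _ _) Finset.disjoint_sdiff
        refine hsub.trans ((Nat.add_le_add_right (hdeg u huT) _).trans ?_)
        rw [← Finset.card_union_of_disjoint hdisj]
        refine Finset.card_le_card ?_
        intro w hw
        rcases Finset.mem_union.1 hw with hw | hw
        · obtain ⟨hwT, hne⟩ := Finset.mem_filter.1 hw
          exact Finset.mem_filter.2 ⟨(Finset.mem_filter.1 hwT).1, by simpa [hwT, huT] using hne⟩
        · obtain ⟨hwS, hwT⟩ := Finset.mem_sdiff.1 hw
          exact Finset.mem_filter.2 ⟨hwS, by simpa [hwT, huT] using (hc u huT).ne'⟩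
      · refine (hv u hu).trans (Finset.card_le_card ?_)
        intro w hw
        exact Finset.mem_filter.2 ⟨(Finset.mem_filter.1 hw).1, by
          simpa only [if_pos hw, if_neg huT] using (hc w hw).ne⟩

/-- The degree power sum of a complete multipartite graph in terms of its relative part sizes. -/
theorem sum_card_ne_rpow {r n : ℕ} (hn : 0 < n) (p : ℝ) (c : Fin n → Fin r) :
    ∑ u, (#{w | c w ≠ c u} : ℝ) ^ p =
      (n : ℝ) ^ (p + 1) *
        ∑ i, (#{w | c w = i} / n : ℝ) * (1 - (#{w | c w = i} / n : ℝ)) ^ p := by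
  have hn' : (0 : ℝ) < n := by exact_mod_cast hn
  have hcard : ∀ i, (#{w | c w = i} : ℝ) + #{w | c w ≠ i} = n := by
    intro i
    have := Finset.card_filter_add_card_filter_not (s := (univ : Finset (Fin n))) (fun w => c w = i)
    rw [Finset.card_univ, Fintype.card_fin] at this
    exact_mod_cast this
  rw [← Finset.sum_fiberwise univ c, Finset.mul_sum]
  refine Finset.sum_congr rfl fun i _ => ?_
  have hfib : ∑ u with c u = i, (#{w | c w ≠ c u} : ℝ) ^ p =
      ∑ u with c u = i, (#{w | c w ≠ i} : ℝ) ^ p := by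
    refine Finset.sum_congr rfl fun u hu => ?_
    rw [(Finset.mem_filter.1 hu).2]
  have hx : (1 - (#{w | c w = i} / n : ℝ)) = #{w | c w ≠ i} / n := by
    rw [← hcard i] at hn' ⊢
    field_simp
    ring
  rw [hfib, Finset.sum_const, nsmul_eq_mul, hx, Real.div_rpow (by positivity) (by positivity),
    Real.rpow_add hn', Real.rpow_one]
  field_simp

theorem bddAbove_psiMax_set (r : ℕ) {p : ℝ} (hp : 0 < p) :
    BddAbove {y | ∃ x : Fin r → ℝ, (∀ i, 0 ≤ x i) ∧ ∑ i, x i = 1 ∧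
      y = ∑ i, x i * (1 - x i) ^ p} := by
  refine ⟨1, ?_⟩
  rintro _ ⟨x, hx, hsum, rfl⟩
  rw [← hsum]
  refine Finset.sum_le_sum fun i _ => mul_le_of_le_one_right (hx i) ?_
  have : x i ≤ 1 := hsum ▸ Finset.single_le_sum (fun j _ => hx j) (Finset.mem_univ i)
  exact Real.rpow_le_one (by linarith) (by linarith [hx i]) hp.le

theorem degPowerSum_le {r n : ℕ} (hn : 0 < n) {p : ℝ} (hp : 0 < p) (G : SimpleGraph (Fin n))
    (hG : G.CliqueFree (r + 1)) : degPowerSum p G ≤ (n : ℝ) ^ (p + 1) * psiMax r p := by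
  classical
  have hn' : (0 : ℝ) < n := by exact_mod_cast hn
  obtain ⟨c', hc', hdeg⟩ := exists_coloring_degree_le G r univ hG.cliqueFreeOn
  let c : Fin n → Fin r := fun u => ⟨c' u, hc' u (Finset.mem_univ u)⟩
  calc degPowerSum p G ≤ ∑ u, (#{w | c w ≠ c u} : ℝ) ^ p := by
        refine Finset.sum_le_sum fun u _ => Real.rpow_le_rpow (by positivity) ?_ hp.le
        have h := hdeg u (Finset.mem_univ u)
        rw [← SimpleGraph.card_neighborFinset_eq_degree, SimpleGraph.neighborFinset_eq_filter]
        simp only [c, ne_eq, Fin.mk.injEq]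
        convert (Nat.cast_le (α := ℝ)).2 h
    _ ≤ _ := by
        rw [sum_card_ne_rpow hn]
        refine mul_le_mul_of_nonneg_left (le_csSup (bddAbove_psiMax_set r hp)
          ⟨fun i => #{w | c w = i} / n, fun i => by positivity, ?_, rfl⟩) (by positivity)
        rw [← Finset.sum_div, ← Nat.cast_sum,
          ← Finset.card_eq_sum_card_fiberwise (fun u _ => Finset.mem_coe.2 (Finset.mem_univ (c u)))]
        simp [hn'.ne']

theorem phiClique_le {r n : ℕ} (hr : 0 < r) (hn : 0 < n) {p : ℝ} (hp : 0 < p) :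
    phiClique r p n ≤ (n : ℝ) ^ (p + 1) * psiMax r p := by
  refine csSup_le ⟨_, ⊥, SimpleGraph.cliqueFree_bot (by omega), rfl⟩ ?_
  rintro _ ⟨G, hG, rfl⟩
  exact degPowerSum_le hn hp G hG

theorem le_phiClique {r n : ℕ} (hn : 0 < n) {p : ℝ} (hp : 0 < p) (c : Fin n → Fin r) :
    ∑ i, (#{w | c w = i} / n : ℝ) * (1 - (#{w | c w = i} / n : ℝ)) ^ p ≤
      phiClique r p n / (n : ℝ) ^ (p + 1) := by
  classical
  have hn' : (0 : ℝ) < n := by exact_mod_cast hn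
  rw [le_div_iff₀ (by positivity), mul_comm, ← sum_card_ne_rpow hn]
  refine le_csSup ⟨(n : ℝ) ^ (p + 1) * psiMax r p, ?_⟩
    ⟨(⊤ : SimpleGraph (Fin r)).comap c, ?_, ?_⟩
  · rintro _ ⟨G, hG, rfl⟩
    exact degPowerSum_le hn hp G hG
  · have hcol : ((⊤ : SimpleGraph (Fin r)).comap c).Colorable r :=
      ⟨⟨c, fun h => h⟩⟩
    exact hcol.cliqueFree (Nat.lt_succ_self r)
  · refine Finset.sum_congr rfl fun u _ => ?_
    rw [← SimpleGraph.card_neighborFinset_eq_degree, SimpleGraph.neighborFinset_eq_filter]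
    congr 3
    ext w
    simp [ne_comm]

/-- If the prescribed sizes fit into `Fin n`, there is a coloring whose classes are that large. -/
theorem exists_coloring_card_ge {r n : ℕ} (hr : 0 < r) (m : Fin r → ℕ) (hm : ∑ i, m i ≤ n) :
    ∃ c : Fin n → Fin r, ∀ i, m i ≤ #{w | c w = i} := by
  have hcard : Fintype.card (Σ i, Fin (m i)) ≤ Fintype.card (Fin n) := by simpa using hm
  obtain ⟨e⟩ := Function.Embedding.nonempty_of_card_le hcard
  refine ⟨Function.extend e Sigma.fst fun _ => ⟨0, hr⟩, fun i => ?_⟩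
  let g : Fin (m i) ↪ Fin n := (Function.Embedding.sigmaMk i).trans e
  calc m i = #(univ.map g) := by simp
    _ ≤ _ := by
      refine Finset.card_le_card fun w hw => ?_
      obtain ⟨k, -, rfl⟩ := Finset.mem_map.1 hw
      refine Finset.mem_filter.2 ⟨Finset.mem_univ _, ?_⟩
      exact e.injective.extend_apply Sigma.fst _ ⟨i, k⟩

/-- Every point of the simplex is a limit of relative class sizes of colorings of `Fin n`. -/
theorem exists_colorings_tendsto {r : ℕ} (hr : 0 < r) (x : Fin r → ℝ) (hx : ∀ i, 0 ≤ x i)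
    (hsum : ∑ i, x i = 1) :
    ∃ c : ∀ n : ℕ, Fin n → Fin r, ∀ i, Filter.Tendsto
      (fun n : ℕ => (#{w | c n w = i} / n : ℝ)) Filter.atTop (nhds (x i)) := by
  have hex : ∀ n : ℕ, ∃ c : Fin n → Fin r, ∀ i, ⌊x i * n⌋₊ ≤ #{w | c w = i} := by
    intro n
    refine exists_coloring_card_ge hr _ ?_
    have : ((∑ i, ⌊x i * n⌋₊ : ℕ) : ℝ) ≤ n := by
      rw [Nat.cast_sum]
      calc ∑ i, ((⌊x i * n⌋₊ : ℕ) : ℝ) ≤ ∑ i, x i * n :=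
            Finset.sum_le_sum fun i _ => Nat.floor_le (mul_nonneg (hx i) n.cast_nonneg)
        _ = n := by rw [← Finset.sum_mul, hsum, one_mul]
    exact_mod_cast this
  choose c hc using hex
  refine ⟨c, fun i => ?_⟩
  have hlow : ∀ n : ℕ, 0 < n → ∀ j, x j - 1 / n ≤ (#{w | c n w = j} / n : ℝ) := by
    intro n hn j
    have hn' : (0 : ℝ) < n := by exact_mod_cast hn
    have h1 : ((⌊x j * n⌋₊ : ℕ) : ℝ) ≤ #{w | c n w = j} := by exact_mod_cast hc n j
    have h2 := Nat.lt_floor_add_one (x j * n)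
    rw [le_div_iff₀ hn', sub_mul, one_div_mul_cancel hn'.ne']
    linarith
  have hup : ∀ n : ℕ, 0 < n → (#{w | c n w = i} / n : ℝ) ≤ x i + r * (1 / n) := by
    intro n hn
    have hn' : (0 : ℝ) < n := by exact_mod_cast hn
    have htot : ∑ j, (#{w | c n w = j} / n : ℝ) = 1 := by
      rw [← Finset.sum_div, ← Nat.cast_sum,
        ← Finset.card_eq_sum_card_fiberwise (fun u _ => Finset.mem_coe.2 (Finset.mem_univ (c n u)))]
      simp [hn'.ne']
    have hsingle := Finset.single_le_sum (f := fun j => (#{w | c n w = j} / n : ℝ) - (x j - 1 / n))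
      (fun j _ => sub_nonneg.2 (hlow n hn j)) (Finset.mem_univ i)
    simp only [Finset.sum_sub_distrib, htot, hsum, Finset.sum_const, Finset.card_univ,
      Fintype.card_fin, nsmul_eq_mul] at hsingle
    have : (0 : ℝ) ≤ 1 / n := by positivity
    linarith
  have hinv : Filter.Tendsto (fun n : ℕ => (1 : ℝ) / n) Filter.atTop (nhds 0) :=
    tendsto_one_div_atTop_nhds_zero_nat
  refine tendsto_of_tendsto_of_tendsto_of_le_of_le'
    (by simpa using hinv.const_sub (x i)) (by simpa using (hinv.const_mul (r : ℝ)).const_add (x i))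
    ?_ ?_
  · filter_upwards [Filter.eventually_gt_atTop 0] with n hn
    simpa using hlow n hn i
  · filter_upwards [Filter.eventually_gt_atTop 0] with n hn
    simpa using hup n hn

theorem stmt19 (r : ℕ) (hr : 2 ≤ r) (p : ℝ) (hp : 0 < p) :
    Filter.Tendsto (fun n : ℕ => phiClique r p n / (n : ℝ) ^ (p + 1))
      Filter.atTop (nhds (psiMax r p)) := by
  have hr0 : 0 < r := by omega
  refine tendsto_order.2 ⟨fun a ha => ?_, fun a ha => ?_⟩
  · have hne : {y | ∃ x : Fin r → ℝ, (∀ i, 0 ≤ x i) ∧ ∑ i, x i = 1 ∧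
        y = ∑ i, x i * (1 - x i) ^ p}.Nonempty :=
      ⟨_, Pi.single ⟨0, hr0⟩ 1, fun i => by
        by_cases h : i = ⟨0, hr0⟩ <;> simp [h], by simp, rfl⟩
    obtain ⟨_, ⟨x, hx, hsum, rfl⟩, hlt⟩ := exists_lt_of_lt_csSup hne ha
    obtain ⟨c, hc⟩ := exists_colorings_tendsto hr0 x hx hsum
    have hlim : Filter.Tendsto (fun n : ℕ =>
        ∑ i, (#{w | c n w = i} / n : ℝ) * (1 - (#{w | c n w = i} / n : ℝ)) ^ p)
        Filter.atTop (nhds (∑ i, x i * (1 - x i) ^ p)) :=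
      tendsto_finsetSum _ fun i _ =>
        (hc i).mul (((hc i).const_sub 1).rpow_const (Or.inr hp.le))
    filter_upwards [hlim.eventually_const_lt hlt, Filter.eventually_gt_atTop 0] with n h hn
    exact h.trans_le (le_phiClique hn hp (c n))
  · filter_upwards [Filter.eventually_gt_atTop 0] with n hn
    have hn' : (0 : ℝ) < n := by exact_mod_cast hn
    refine lt_of_le_of_lt ?_ ha
    rw [div_le_iff₀ (by positivity), mul_comm]
    exact phiClique_le hr0 hn hp
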